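/- Let S be an inverse semigroup and N a normal inverse subsemigroup of S. The relation ≤_N is a preorder on S (it is reflexive and transitive), and hence the relation ≃_N, defined by s ≃_N t iff s ≤_N t and t ≤_N s, is an equivalence relation on S. -/

import Mathlib

/-- An inverse semigroup: a semigroup in which every element `s` has a
(unique) inverse `s⁻¹` with `s * s⁻¹ * s = s` and `s⁻¹ * s * s⁻¹ = s⁻¹`. -/
class InverseSemigroup (S : Type*) extends Semigroup S, Inv S where
  mul_inv_mul : ∀ s : S, s * s⁻¹ * s = s
  inv_mul_inv : ∀ s : S, s⁻¹ * s * s⁻¹ = s⁻¹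
  inv_unique : ∀ s t : S, s * t * s = s → t * s * t = t → t = s⁻¹

/-- The natural partial order on an inverse semigroup:
`s ≤ t` iff `s = e * t` for some idempotent `e`. -/
def NatLe {S : Type*} [InverseSemigroup S] (s t : S) : Prop :=
  ∃ e : S, IsIdempotentElem e ∧ s = e * t

/-- A normal inverse subsemigroup: a full inverse subsemigroup that is
closed under conjugation. -/
structure IsNormalInverseSubsemigroup {S : Type*} [InverseSemigroup S] (N : Set S) : Prop where
  mul_mem : ∀ {a b : S}, a ∈ N → b ∈ N → a * b ∈ N
  inv_mem : ∀ {a : S}, a ∈ N → a⁻¹ ∈ N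
  full : ∀ {e : S}, IsIdempotentElem e → e ∈ N
  conj_mem : ∀ (s : S) {n : S}, n ∈ N → s⁻¹ * n * s ∈ N

/-- The preorder `≤_N` associated to a normal inverse subsemigroup `N`:
`s ≤_N t` iff there are `a, b ∈ N` with `a⁻¹ * a = s * s⁻¹`,
`s⁻¹ * s = b * b⁻¹` (so `a · s · b` is a trace product) and `a * s * b ≤ t`. -/
def LeN {S : Type*} [InverseSemigroup S] (N : Set S) (s t : S) : Prop :=
  ∃ a ∈ N, ∃ b ∈ N, a⁻¹ * a = s * s⁻¹ ∧ s⁻¹ * s = b * b⁻¹ ∧ NatLe (a * s * b) t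

/-- The equivalence `≃_N` obtained by symmetrizing `≤_N`. -/
def SimeqN {S : Type*} [InverseSemigroup S] (N : Set S) (s t : S) : Prop :=
  LeN N s t ∧ LeN N t s

namespace InverseSemigroup

variable {S : Type*} [InverseSemigroup S]

theorem inv_eq_self {e : S} (he : IsIdempotentElem e) : e⁻¹ = e :=
  (inv_unique e e (by rw [he.eq, he.eq]) (by rw [he.eq, he.eq])).symm

theorem isIdempotentElem_mul_inv (s : S) : IsIdempotentElem (s * s⁻¹) := by
  rw [IsIdempotentElem, ← mul_assoc, mul_inv_mul]

theorem isIdempotentElem_inv_mul (s : S) : IsIdempotentElem (s⁻¹ * s) := by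
  rw [IsIdempotentElem, ← mul_assoc, inv_mul_inv]

theorem isIdempotentElem_mul {e f : S} (he : IsIdempotentElem e) (hf : IsIdempotentElem f) :
    IsIdempotentElem (e * f) := by
  have hx : f * (e * f)⁻¹ * e = (e * f)⁻¹ := by
    refine inv_unique (e * f) _ ?_ ?_
    · calc e * f * (f * (e * f)⁻¹ * e) * (e * f)
          = e * (f * f) * (e * f)⁻¹ * (e * e * f) := by simp only [mul_assoc]
        _ = e * f := by rw [hf.eq, he.eq, mul_inv_mul]
    · calc f * (e * f)⁻¹ * e * (e * f) * (f * (e * f)⁻¹ * e)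
          = f * ((e * f)⁻¹ * (e * e * (f * f)) * (e * f)⁻¹) * e := by simp only [mul_assoc]
        _ = f * (e * f)⁻¹ * e := by rw [hf.eq, he.eq, inv_mul_inv]
  have hi : IsIdempotentElem (e * f)⁻¹ := by
    calc (e * f)⁻¹ * (e * f)⁻¹
        = f * (e * f)⁻¹ * e * (f * (e * f)⁻¹ * e) := by rw [hx]
      _ = f * ((e * f)⁻¹ * (e * f) * (e * f)⁻¹) * e := by simp only [mul_assoc]
      _ = (e * f)⁻¹ := by rw [inv_mul_inv, hx]
  have h : e * f = (e * f)⁻¹ :=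
    (inv_unique (e * f)⁻¹ (e * f) (inv_mul_inv _) (mul_inv_mul _)).trans (inv_eq_self hi)
  rw [h]
  exact hi

theorem mul_comm_of_isIdempotentElem {e f : S} (he : IsIdempotentElem e)
    (hf : IsIdempotentElem f) : e * f = f * e := by
  have key : ∀ {a b : S}, IsIdempotentElem a → IsIdempotentElem b →
      a * b * (b * a) * (a * b) = a * b := fun {a b} ha hb => by
    calc a * b * (b * a) * (a * b) = a * (b * b) * (a * a * b) := by simp only [mul_assoc]
      _ = a * b := by rw [hb.eq, ha.eq, (isIdempotentElem_mul ha hb).eq]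
  rw [inv_unique (e * f) (f * e) (key he hf) (key hf he),
    inv_eq_self (isIdempotentElem_mul he hf)]

protected theorem mul_inv_rev (s t : S) : (s * t)⁻¹ = t⁻¹ * s⁻¹ := by
  have hc : t * t⁻¹ * (s⁻¹ * s) = s⁻¹ * s * (t * t⁻¹) :=
    mul_comm_of_isIdempotentElem (isIdempotentElem_mul_inv t) (isIdempotentElem_inv_mul s)
  refine (inv_unique _ _ ?_ ?_).symm
  · calc s * t * (t⁻¹ * s⁻¹) * (s * t)
        = s * (t * t⁻¹ * (s⁻¹ * s)) * t := by simp only [mul_assoc]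
      _ = s * s⁻¹ * s * (t * t⁻¹ * t) := by rw [hc]; simp only [mul_assoc]
      _ = s * t := by rw [mul_inv_mul, mul_inv_mul]
  · calc t⁻¹ * s⁻¹ * (s * t) * (t⁻¹ * s⁻¹)
        = t⁻¹ * (s⁻¹ * s * (t * t⁻¹)) * s⁻¹ := by simp only [mul_assoc]
      _ = t⁻¹ * t * t⁻¹ * (s⁻¹ * s * s⁻¹) := by rw [← hc]; simp only [mul_assoc]
      _ = t⁻¹ * s⁻¹ := by rw [inv_mul_inv, inv_mul_inv]

theorem isIdempotentElem_conj (c : S) {e : S} (he : IsIdempotentElem e) :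
    IsIdempotentElem (c * e * c⁻¹) := by
  have hc := mul_comm_of_isIdempotentElem (isIdempotentElem_inv_mul c) he
  calc c * e * c⁻¹ * (c * e * c⁻¹) = c * e * (c⁻¹ * c * e) * c⁻¹ := by simp only [mul_assoc]
    _ = c * (e * e) * (c⁻¹ * c * c⁻¹) := by rw [hc]; simp only [mul_assoc]
    _ = c * e * c⁻¹ := by rw [he.eq, inv_mul_inv]

end InverseSemigroup

section

open InverseSemigroup

variable {S : Type*} [InverseSemigroup S]

theorem NatLe.mul_inv_mul_left {s t : S} (h : NatLe s t) : t * t⁻¹ * s = s := by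
  obtain ⟨e, he, rfl⟩ := h
  rw [← mul_assoc, mul_comm_of_isIdempotentElem (isIdempotentElem_mul_inv t) he, mul_assoc,
    mul_inv_mul]

theorem NatLe.mul_inv_mul_right {s t : S} (h : NatLe s t) : s * (t⁻¹ * t) = s := by
  obtain ⟨e, -, rfl⟩ := h
  rw [mul_assoc, ← mul_assoc t, mul_inv_mul]

theorem NatLe.trans {s t u : S} (hst : NatLe s t) (htu : NatLe t u) : NatLe s u := by
  obtain ⟨e, he, rfl⟩ := hst
  obtain ⟨f, hf, rfl⟩ := htu
  exact ⟨e * f, isIdempotentElem_mul he hf, (mul_assoc _ _ _).symm⟩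

theorem NatLe.mul_left {s t : S} (h : NatLe s t) (c : S) : NatLe (c * s) (c * t) := by
  obtain ⟨e, he, rfl⟩ := h
  refine ⟨c * e * c⁻¹, isIdempotentElem_conj c he, ?_⟩
  calc c * (e * t) = c * c⁻¹ * c * e * t := by rw [mul_inv_mul, mul_assoc]
    _ = c * (c⁻¹ * c * e) * t := by simp only [mul_assoc]
    _ = c * e * c⁻¹ * (c * t) := by
      rw [mul_comm_of_isIdempotentElem (isIdempotentElem_inv_mul c) he]
      simp only [mul_assoc]

theorem NatLe.mul_right {s t : S} (h : NatLe s t) (d : S) : NatLe (s * d) (t * d) := by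
  obtain ⟨e, he, rfl⟩ := h
  exact ⟨e, he, mul_assoc _ _ _⟩

theorem LeN.refl {N : Set S} (hN : IsNormalInverseSubsemigroup N) (s : S) : LeN N s s := by
  have hl := isIdempotentElem_mul_inv s
  have hr := isIdempotentElem_inv_mul s
  refine ⟨s * s⁻¹, hN.full hl, s⁻¹ * s, hN.full hr, ?_, ?_, s * s⁻¹, hl, ?_⟩
  · rw [inv_eq_self hl, hl.eq]
  · rw [inv_eq_self hr, hr.eq]
  · rw [mul_inv_mul, ← mul_assoc, mul_inv_mul]

theorem LeN.trans {N : Set S} (hN : IsNormalInverseSubsemigroup N) {s t u : S}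
    (hst : LeN N s t) (htu : LeN N t u) : LeN N s u := by
  obtain ⟨a, ha, b, hb, has, hsb, hw⟩ := hst
  obtain ⟨c, hc, d, hd, hct, htd, hv⟩ := htu
  have ha_eq : a * s * b * (b⁻¹ * s⁻¹) = a := by
    calc a * s * b * (b⁻¹ * s⁻¹) = a * s * (b * b⁻¹) * s⁻¹ := by simp only [mul_assoc]
      _ = a * (s * s⁻¹ * s * s⁻¹) := by rw [← hsb]; simp only [mul_assoc]
      _ = a := by rw [mul_inv_mul, ← has, ← mul_assoc, mul_inv_mul]
  have hb_eq : s⁻¹ * a⁻¹ * (a * s * b) = b := by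
    calc s⁻¹ * a⁻¹ * (a * s * b) = s⁻¹ * (a⁻¹ * a) * s * b := by simp only [mul_assoc]
      _ = s⁻¹ * s * s⁻¹ * s * b := by rw [has]; simp only [mul_assoc]
      _ = b := by rw [inv_mul_inv, hsb, mul_inv_mul]
  have hta : t * t⁻¹ * a = a := by
    rw [← ha_eq, ← mul_assoc, hw.mul_inv_mul_left]
  have hbt : b * (t⁻¹ * t) = b := by
    rw [← hb_eq, mul_assoc, hw.mul_inv_mul_right]
  refine ⟨c * a, hN.mul_mem hc ha, b * d, hN.mul_mem hb hd, ?_, ?_, ?_⟩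
  · rw [InverseSemigroup.mul_inv_rev, mul_assoc, ← mul_assoc c⁻¹, hct, hta, has]
  · rw [InverseSemigroup.mul_inv_rev, ← mul_assoc, mul_assoc b, ← htd, hbt, hsb]
  · have h := ((hw.mul_left c).mul_right d).trans hv
    simpa only [mul_assoc] using h

end

/-- `≤_N` is a preorder on `S`, and hence `≃_N` is an equivalence relation. -/
theorem leN_isPreorder_and_simeqN_equivalence {S : Type*} [InverseSemigroup S] {N : Set S}
    (hN : IsNormalInverseSubsemigroup N) :
    (Reflexive (LeN N) ∧ Transitive (LeN N)) ∧ Equivalence (SimeqN N) := by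
  exact ⟨⟨LeN.refl hN, fun _ _ _ => LeN.trans hN⟩, fun s => ⟨LeN.refl hN s, LeN.refl hN s⟩,
    fun h => ⟨h.2, h.1⟩, fun h k => ⟨h.1.trans hN k.1, k.2.trans hN h.2⟩⟩
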